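/- arXiv:funct-an/9610002 — 5 statements merged into one kernel-verified Lean document; each statement's English description precedes it below -/
import Mathlib

section
/- Let H be a finite-dimensional Hopf algebra over a field k such that the dual convolution algebra H* is a semisimple ring. Then H has only finitely many Hopf subalgebras; i.e., the set of Hopf subalgebras of H is finite. -/
open TensorProduct

/-- The convolution product on the dual space of a coalgebra:
`(f * g)(h) = Σ f(h₍₁₎) g(h₍₂₎)`, i.e. `fg = mul ∘ (f ⊗ g) ∘ Δ`. -/
noncomputable def dualConv {k H : Type*} [CommSemiring k] [AddCommMonoid H] [Module k H]
    [Coalgebra k H] (f g : Module.Dual k H) : Module.Dual k H :=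
  LinearMap.mul' k k ∘ₗ TensorProduct.map f g ∘ₗ Coalgebra.comul

/-- Semisimple rings are von Neumann regular. -/
theorem IsSemisimpleRing.exists_mul_mul_eq_self {R : Type*} [Ring R] [IsSemisimpleRing R] (a : R) :
    ∃ x, a * x * a = a := by
  obtain ⟨e, he, hspan⟩ := IsSemisimpleRing.ideal_eq_span_idempotent (Ideal.span {a})
  obtain ⟨x, hx⟩ := Ideal.mem_span_singleton'.1
    (hspan ▸ Ideal.mem_span_singleton_self e : e ∈ Ideal.span {a})
  obtain ⟨y, hy⟩ := Ideal.mem_span_singleton'.1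
    (hspan ▸ Ideal.mem_span_singleton_self a : a ∈ Ideal.span {e})
  exact ⟨x, by rw [mul_assoc, hx, ← hy, mul_assoc, he.eq]⟩

/-- Artinian von Neumann regular rings are semisimple. -/
theorem IsArtinianRing.isSemisimpleRing_of_exists_mul_mul_eq_self {R : Type*} [Ring R]
    [IsArtinianRing R] (h : ∀ a : R, ∃ x, a * x * a = a) : IsSemisimpleRing R := by
  rw [IsArtinianRing.isSemisimpleRing_iff_jacobson, ← Ideal.jacobson_bot, eq_bot_iff]
  intro a ha
  obtain ⟨x, hx⟩ := h a
  obtain ⟨z, hz⟩ := Ideal.mem_jacobson_iff.1 ha (-x)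
  have hz' : z * (1 - x * a) = 1 := by
    rw [Ideal.mem_bot, sub_eq_zero] at hz
    exact Eq.trans (by noncomm_ring) hz
  have hunit : (1 - x * a) * z = 1 := mul_eq_one_symm hz'
  calc a = a * ((1 - x * a) * z) := by rw [hunit, mul_one]
    _ = (a - a * x * a) * z := by noncomm_ring
    _ = 0 := by rw [hx, sub_self, zero_mul]

/-- A semisimple ring has only finitely many two-sided ideals. -/
theorem IsSemisimpleRing.finite_isTwoSided (R : Type*) [Ring R] [IsSemisimpleRing R] :
    {I : Ideal R | I.IsTwoSided}.Finite := by
  have : Finite (fullyInvariantSubmodule R R) :=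
    .of_equiv _ (OrderIso.setIsotypicComponents (R := R) (M := R)).toEquiv
  exact (Set.toFinite (fullyInvariantSubmodule R R : Set (Submodule R R))).subset
    fun I hI ↦ isFullyInvariant_iff_isTwoSided.2 hI

/-- The ideal of functionals vanishing on a subspace, in the convolution algebra dual to a
coalgebra, provided the subspace is a subcoalgebra. -/
def annihilatorIdeal {k C : Type*} [Field k] [AddCommGroup C] [Module k C] [Coalgebra k C]
    (W : Submodule k C)
    (hW : ∀ x ∈ W, Coalgebra.comul (R := k) x ∈
      LinearMap.range (TensorProduct.map W.subtype W.subtype)) :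
    Ideal (WithConv (C →ₗ[k] k)) where
  carrier := {f | f.ofConv ∈ W.dualAnnihilator}
  zero_mem' := zero_mem W.dualAnnihilator
  add_mem' hf hg := W.dualAnnihilator.add_mem hf hg
  smul_mem' g f hf := by
    refine (Submodule.mem_dualAnnihilator (W := W) _).2 fun x hx ↦ ?_
    obtain ⟨t, ht⟩ := hW x hx
    have hf0 : f.ofConv ∘ₗ W.subtype = 0 :=
      LinearMap.ext fun w ↦ (Submodule.mem_dualAnnihilator _).1 hf w w.2
    rw [smul_eq_mul, LinearMap.convMul_apply, ← ht, ← LinearMap.comp_apply (TensorProduct.map _ _),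
      ← TensorProduct.map_comp, hf0, TensorProduct.map_zero_right]
    simp

instance {k C : Type*} [Field k] [AddCommGroup C] [Module k C] [Coalgebra k C]
    (W : Submodule k C)
    (hW : ∀ x ∈ W, Coalgebra.comul (R := k) x ∈
      LinearMap.range (TensorProduct.map W.subtype W.subtype)) :
    (annihilatorIdeal W hW).IsTwoSided where
  mul_mem_of_left {f} g hf := by
    refine (Submodule.mem_dualAnnihilator (W := W) _).2 fun x hx ↦ ?_
    obtain ⟨t, ht⟩ := hW x hx
    have hf0 : f.ofConv ∘ₗ W.subtype = 0 :=
      LinearMap.ext fun w ↦ (Submodule.mem_dualAnnihilator _).1 hf w w.2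
    rw [LinearMap.convMul_apply, ← ht, ← LinearMap.comp_apply (TensorProduct.map _ _),
      ← TensorProduct.map_comp, hf0, TensorProduct.map_zero_left]
    simp

/-- A coalgebra over a field whose dual convolution algebra is semisimple has only finitely many
subcoalgebras. -/
theorem finite_subcoalgebras_of_isSemisimpleRing (k C : Type*) [Field k] [AddCommGroup C]
    [Module k C] [Coalgebra k C] [IsSemisimpleRing (WithConv (C →ₗ[k] k))] :
    {W : Submodule k C | ∀ x ∈ W, Coalgebra.comul (R := k) x ∈
      LinearMap.range (TensorProduct.map W.subtype W.subtype)}.Finite := by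
  have := (IsSemisimpleRing.finite_isTwoSided (WithConv (C →ₗ[k] k))).to_subtype
  refine Finite.of_injective (β := {I : Ideal (WithConv (C →ₗ[k] k)) | I.IsTwoSided})
    (fun W ↦ ⟨annihilatorIdeal W.1 W.2, inferInstanceAs (annihilatorIdeal W.1 W.2).IsTwoSided⟩)
    fun V W h ↦ Subtype.ext (Subspace.dualAnnihilator_inj.1 (Submodule.ext fun f ↦ ?_))
  have h' : annihilatorIdeal V.1 V.2 = annihilatorIdeal W.1 W.2 := Subtype.ext_iff.1 h
  exact SetLike.ext_iff.1 h' (WithConv.toConv f)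

/-- Let `H` be a finite-dimensional Hopf algebra over a field `k` such that the dual
convolution algebra `H*` (the ring structure on `Module.Dual k H` whose multiplication
is the convolution product and whose unit is the counit `ε`) is semisimple.  Then `H`
has only finitely many Hopf subalgebras. -/
theorem finite_subHopfAlgebras_of_semisimple_dual
    (k H : Type*) [Field k] [Ring H] [HopfAlgebra k H] [FiniteDimensional k H]
    [inst : Ring (Module.Dual k H)]
    (hmul : ∀ f g : Module.Dual k H, f * g = dualConv f g)
    (hone : (1 : Module.Dual k H) = Coalgebra.counit)
    (hss : IsSemisimpleRing (Module.Dual k H)) :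
    {K : Subalgebra k H |
      (∀ x ∈ K, HopfAlgebra.antipode (R := k) x ∈ K) ∧
      (∀ x ∈ K, Coalgebra.comul (R := k) x ∈
        LinearMap.range (TensorProduct.map K.val.toLinearMap K.val.toLinearMap))}.Finite := by
  have regular (a : WithConv (H →ₗ[k] k)) : ∃ x, a * x * a = a := by
    obtain ⟨x, hx⟩ := IsSemisimpleRing.exists_mul_mul_eq_self (R := Module.Dual k H) a.ofConv
    refine ⟨WithConv.toConv x, WithConv.ext ?_⟩
    rw [hmul, hmul] at hx
    exact hx
  have : Module.Finite k (WithConv (H →ₗ[k] k)) :=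
    .equiv (WithConv.linearEquiv k (H →ₗ[k] k)).symm
  have : IsArtinianRing (WithConv (H →ₗ[k] k)) := isArtinian_of_tower k inferInstance
  have := IsArtinianRing.isSemisimpleRing_of_exists_mul_mul_eq_self regular
  exact ((finite_subcoalgebras_of_isSemisimpleRing k H).preimage
    Subalgebra.toSubmodule_injective.injOn).subset fun K hK ↦ hK.2
end

section
/- Let G be a finite group, let H ⊆ A be subgroups of G with H ≤ A ≤ G, and let k be a field of characteristic zero (e.g. ℂ). Then e_A = e_H e_A e_H, so e_A lies in the corner algebra e_H k[G] e_H, and e_A is a central element of the corner algebra e_H k[G] e_H (equivalently, e_A commutes with e_H g e_H for every g ∈ G) if and only if the double-coset-type sets satisfy A g H = H g A for every g ∈ G. -/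
open scoped Pointwise

/-- The averaging idempotent `e_S = |S|⁻¹ Σ_{s ∈ S} s` of a finite subgroup `S`
in the group algebra `k[G]`. -/
noncomputable def avgIdem (k : Type*) [Field k] {G : Type*} [Group G]
    (S : Subgroup G) [Fintype S] : MonoidAlgebra k G :=
  (Nat.card S : k)⁻¹ • ∑ s : S, MonoidAlgebra.of k G (s : G)

section AvgIdem

variable {k : Type*} [Field k] {G : Type*} [Group G]

/-- If `x * s * y` does not depend on `s ∈ S`, it equals `x * e_S * y`. -/
lemma mul_avgIdem_mul_eq [CharZero k] (S : Subgroup G) [Fintype S] {x y z : MonoidAlgebra k G}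
    (h : ∀ s ∈ S, x * MonoidAlgebra.of k G s * y = z) : x * avgIdem k S * y = z := by
  have hS : (Nat.card S : k) ≠ 0 := Nat.cast_ne_zero.mpr Nat.card_pos.ne'
  rw [avgIdem, mul_smul_comm, smul_mul_assoc, Finset.mul_sum, Finset.sum_mul,
    Finset.sum_congr rfl fun (s : S) _ => h s s.2, Finset.sum_const, Finset.card_univ,
    ← Nat.card_eq_fintype_card, ← Nat.cast_smul_eq_nsmul k, inv_smul_smul₀ hS]

lemma of_mul_avgIdem (S : Subgroup G) [Fintype S] {s : G} (hs : s ∈ S) :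
    MonoidAlgebra.of k G s * avgIdem k S = avgIdem k S := by
  rw [avgIdem, mul_smul_comm, Finset.mul_sum]
  congr 1
  exact Fintype.sum_equiv (Equiv.mulLeft ⟨s, hs⟩) _ _ fun t => by simp

lemma avgIdem_mul_of (S : Subgroup G) [Fintype S] {s : G} (hs : s ∈ S) :
    avgIdem k S * MonoidAlgebra.of k G s = avgIdem k S := by
  rw [avgIdem, smul_mul_assoc, Finset.sum_mul]
  congr 1
  exact Fintype.sum_equiv (Equiv.mulRight ⟨s, hs⟩) _ _ fun t => by simp

lemma avgIdem_mul_avgIdem_of_le [CharZero k] {H A : Subgroup G} [Fintype H] [Fintype A]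
    (hHA : H ≤ A) : avgIdem k H * avgIdem k A = avgIdem k A := by
  rw [← one_mul (avgIdem k H)]
  exact mul_avgIdem_mul_eq H fun s hs => by rw [one_mul, of_mul_avgIdem A (hHA hs)]

lemma avgIdem_mul_avgIdem_of_ge [CharZero k] {H A : Subgroup G} [Fintype H] [Fintype A]
    (hHA : H ≤ A) : avgIdem k A * avgIdem k H = avgIdem k A := by
  rw [← mul_one (avgIdem k A * avgIdem k H)]
  exact mul_avgIdem_mul_eq H fun s hs => by rw [mul_one, avgIdem_mul_of A (hHA hs)]

/-- The support of `e_S g e_T` is the double coset `S g T`. -/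
lemma avgIdem_mul_of_mul_avgIdem_apply_ne_zero_iff [CharZero k] (S T : Subgroup G) [Fintype S]
    [Fintype T] (g x : G) :
    (avgIdem k S * MonoidAlgebra.of k G g * avgIdem k T).coeff x ≠ 0 ↔
      x ∈ (S : Set G) * {g} * (T : Set G) := by
  classical
  have hcoeff : (avgIdem k S * MonoidAlgebra.of k G g * avgIdem k T).coeff x =
      (Nat.card T : k)⁻¹ * ((Nat.card S : k)⁻¹ *
        ((∑ t : T, ∑ s : S, if (s : G) * g * t = x then 1 else 0 : ℕ) : k)) := by
    simp only [avgIdem, smul_mul_assoc, mul_smul_comm, Finset.sum_mul, Finset.mul_sum,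
      ← map_mul]
    simp [-map_mul, MonoidAlgebra.of_apply, Finsupp.single_apply, ← Finset.mul_sum]
  rw [hcoeff, Finset.sum_comm, mul_ne_zero_iff, mul_ne_zero_iff, Nat.cast_ne_zero]
  simp [Set.mem_mul, -Set.mul_singleton, -Set.image_mul_right]

/-- `e_A` commutes with the corner algebra `e_H k[G] e_H` iff `e_A g e_H = e_H g e_A` for all
group elements `g`. -/
lemma forall_commute_avgIdem_iff [CharZero k] {H A : Subgroup G} [Fintype H] [Fintype A]
    (hHA : H ≤ A) :
    (∀ x : MonoidAlgebra k G, Commute (avgIdem k A) (avgIdem k H * x * avgIdem k H)) ↔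
      ∀ g : G, avgIdem k A * MonoidAlgebra.of k G g * avgIdem k H =
        avgIdem k H * MonoidAlgebra.of k G g * avgIdem k A := by
  have hcomm (x : MonoidAlgebra k G) :
      Commute (avgIdem k A) (avgIdem k H * x * avgIdem k H) ↔
        avgIdem k A * x * avgIdem k H = avgIdem k H * x * avgIdem k A := by
    rw [commute_iff_eq, mul_assoc _ (avgIdem k H) (avgIdem k A), avgIdem_mul_avgIdem_of_le hHA,
      ← mul_assoc, ← mul_assoc, avgIdem_mul_avgIdem_of_ge hHA]
  simp only [hcomm]
  refine ⟨fun h g => h _, fun h x => ?_⟩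
  induction x using MonoidAlgebra.induction_on with
  | of g => exact h g
  | add x y hx hy => simp only [mul_add, add_mul, hx, hy]
  | smul r x hx => simp only [mul_smul_comm, smul_mul_assoc, hx]

/-- If `A g H = H g A`, then both `e_A g e_H` and `e_H g e_A` equal `e_A g e_A`. -/
lemma avgIdem_mul_of_mul_avgIdem_comm [CharZero k] {H A : Subgroup G} [Fintype H] [Fintype A]
    (hHA : H ≤ A) {g : G}
    (h : (A : Set G) * {g} * (H : Set G) = (H : Set G) * {g} * (A : Set G)) :
    avgIdem k A * MonoidAlgebra.of k G g * avgIdem k H =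
      avgIdem k H * MonoidAlgebra.of k G g * avgIdem k A := by
  have hright : avgIdem k A * MonoidAlgebra.of k G g * avgIdem k A * avgIdem k H =
      avgIdem k A * MonoidAlgebra.of k G g * avgIdem k H := by
    refine mul_avgIdem_mul_eq A fun a ha => ?_
    have hmem : g * a ∈ (A : Set G) * {g} * (H : Set G) := by
      rw [h]
      exact Set.mul_mem_mul (Set.mem_mul.mpr ⟨1, H.one_mem, g, rfl, one_mul g⟩) ha
    obtain ⟨_, ⟨b, hb, _, rfl, rfl⟩, c, hc, hbc⟩ := hmem
    rw [mul_assoc (avgIdem k A), ← map_mul, ← hbc]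
    simp only [map_mul, ← mul_assoc]
    rw [avgIdem_mul_of A hb, mul_assoc _ (MonoidAlgebra.of k G c), of_mul_avgIdem H hc]
  have hleft : avgIdem k H * avgIdem k A * (MonoidAlgebra.of k G g * avgIdem k A) =
      avgIdem k H * MonoidAlgebra.of k G g * avgIdem k A := by
    refine mul_avgIdem_mul_eq A fun a ha => ?_
    have hmem : a * g ∈ (H : Set G) * {g} * (A : Set G) := by
      rw [← h]
      exact Set.mem_mul.mpr ⟨a * g, Set.mul_mem_mul ha rfl, 1, H.one_mem, mul_one _⟩
    obtain ⟨_, ⟨b, hb, _, rfl, rfl⟩, c, hc, hbc⟩ := hmem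
    rw [← mul_assoc, mul_assoc (avgIdem k H), ← map_mul, ← hbc]
    simp only [map_mul, ← mul_assoc]
    rw [avgIdem_mul_of H hb, mul_assoc _ (MonoidAlgebra.of k G c), of_mul_avgIdem A hc]
  rw [← hright, ← hleft, mul_assoc _ (avgIdem k A) (avgIdem k H),
    avgIdem_mul_avgIdem_of_ge hHA, avgIdem_mul_avgIdem_of_le hHA, mul_assoc]

end AvgIdem

/-- Let `G` be a finite group, `H ≤ A ≤ G` subgroups, and `k` a field of characteristic
zero.  Then `e_A = e_H e_A e_H`, so `e_A` lies in the corner algebra `e_H k[G] e_H`, and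
`e_A` is central in the corner algebra `e_H k[G] e_H` (i.e. `e_A` commutes with every
`e_H x e_H`) if and only if `A g H = H g A` for every `g ∈ G`. -/
theorem avgIdem_central_in_corner_iff
    (k : Type*) [Field k] [CharZero k]
    (G : Type*) [Group G] [Fintype G]
    (H A : Subgroup G) [Fintype H] [Fintype A] (hHA : H ≤ A) :
    avgIdem k A = avgIdem k H * avgIdem k A * avgIdem k H ∧
    ((∀ x : MonoidAlgebra k G,
        Commute (avgIdem k A) (avgIdem k H * x * avgIdem k H)) ↔
      ∀ g : G, (A : Set G) * {g} * (H : Set G) = (H : Set G) * {g} * (A : Set G)) := by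
  rw [avgIdem_mul_avgIdem_of_le hHA, avgIdem_mul_avgIdem_of_ge hHA, forall_commute_avgIdem_iff hHA]
  refine ⟨rfl, fun h g => Set.ext fun x => ?_, fun h g => avgIdem_mul_of_mul_avgIdem_comm hHA (h g)⟩
  rw [← avgIdem_mul_of_mul_avgIdem_apply_ne_zero_iff (k := k), h g,
    avgIdem_mul_of_mul_avgIdem_apply_ne_zero_iff]
end

section
/- Let n ≥ 3 be odd, let σ = finRotate n be the n-cycle in S_n = Equiv.Perm (Fin n), let P be the stabilizer of a fixed point p ∈ Fin n, and let A_{n−1} = P ∩ A_n be the subgroup of even permutations fixing p, where A_n is the alternating group on Fin n. Then σ is an even permutation and the set products satisfy A_{n−1}·⟨σ⟩ = A_n = ⟨σ⟩·A_{n−1}; in particular A_{n−1}·⟨σ⟩ = ⟨σ⟩·A_{n−1}. -/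
open scoped Pointwise

/-- If `K ≤ H` is transitive, then `H` is the product of `K` and a point stabilizer in `H`. -/
theorem Subgroup.mul_stabilizer_inf_eq {G α : Type*} [Group G] [MulAction G α]
    {K H : Subgroup G} (hKH : K ≤ H) (a : α) (hK : ∀ b : α, ∃ k ∈ K, k • a = b) :
    (K : Set G) * ((MulAction.stabilizer G a ⊓ H : Subgroup G) : Set G) = (H : Set G) := by
  ext g
  rw [Set.mem_mul]
  constructor
  · rintro ⟨k, hk, h, hh, rfl⟩
    exact H.mul_mem (hKH hk) hh.2
  · intro hg
    obtain ⟨k, hk, hka⟩ := hK (g • a)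
    refine ⟨k, hk, k⁻¹ * g, ⟨?_, H.mul_mem (H.inv_mem (hKH hk)) hg⟩, mul_inv_cancel_left k g⟩
    change (k⁻¹ * g) • a = a
    rw [mul_smul, ← hka, inv_smul_smul]

/-- If `K ≤ H` is transitive, then `H` is the product of a point stabilizer in `H` and `K`. -/
theorem Subgroup.stabilizer_inf_mul_eq {G α : Type*} [Group G] [MulAction G α]
    {K H : Subgroup G} (hKH : K ≤ H) (a : α) (hK : ∀ b : α, ∃ k ∈ K, k • a = b) :
    ((MulAction.stabilizer G a ⊓ H : Subgroup G) : Set G) * (K : Set G) = (H : Set G) := by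
  simpa only [mul_inv_rev, inv_coe_set] using
    congrArg (·⁻¹) (Subgroup.mul_stabilizer_inf_eq hKH a hK)

theorem exists_mem_zpowers_finRotate_smul_eq {n : ℕ} (hn : 2 ≤ n) (p q : Fin n) :
    ∃ k ∈ Subgroup.zpowers (finRotate n), k • p = q := by
  have moved (x : Fin n) : finRotate n x ≠ x := by
    rw [← Equiv.Perm.mem_support, support_finRotate_of_le hn]
    exact Finset.mem_univ x
  obtain ⟨i, hi⟩ := (isCycle_finRotate_of_le hn).sameCycle (moved p) (moved q)
  exact ⟨finRotate n ^ i, ⟨i, rfl⟩, hi⟩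

theorem finRotate_mem_alternatingGroup_of_odd {n : ℕ} (hodd : Odd n) :
    finRotate n ∈ alternatingGroup (Fin n) := by
  obtain ⟨m, rfl⟩ := hodd
  exact Equiv.Perm.finRotate_bit1_mem_alternatingGroup

/-- Let `n ≥ 3` be odd, `σ = finRotate n` the `n`-cycle in `S_n = Equiv.Perm (Fin n)`,
`P` the stabilizer of a point `p ∈ Fin n`, and `A_{n-1} = P ∩ A_n` the even permutations
fixing `p`.  Then `σ` is even and `A_{n-1}·⟨σ⟩ = A_n = ⟨σ⟩·A_{n-1}`; in particular
`A_{n-1}·⟨σ⟩ = ⟨σ⟩·A_{n-1}`. -/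
theorem alternating_factorization_of_odd
    (n : ℕ) (hn : 3 ≤ n) (hodd : Odd n) (p : Fin n) :
    finRotate n ∈ alternatingGroup (Fin n) ∧
    ((MulAction.stabilizer (Equiv.Perm (Fin n)) p ⊓ alternatingGroup (Fin n) :
        Subgroup (Equiv.Perm (Fin n))) : Set (Equiv.Perm (Fin n))) *
        (Subgroup.zpowers (finRotate n) : Set (Equiv.Perm (Fin n))) =
      (alternatingGroup (Fin n) : Set (Equiv.Perm (Fin n))) ∧
    (Subgroup.zpowers (finRotate n) : Set (Equiv.Perm (Fin n))) *
        ((MulAction.stabilizer (Equiv.Perm (Fin n)) p ⊓ alternatingGroup (Fin n) :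
          Subgroup (Equiv.Perm (Fin n))) : Set (Equiv.Perm (Fin n))) =
      (alternatingGroup (Fin n) : Set (Equiv.Perm (Fin n))) := by
  have hσ := finRotate_mem_alternatingGroup_of_odd hodd
  have hle : Subgroup.zpowers (finRotate n) ≤ alternatingGroup (Fin n) :=
    Subgroup.zpowers_le.2 hσ
  have htrans := exists_mem_zpowers_finRotate_smul_eq (show 2 ≤ n by omega) p
  exact ⟨hσ, Subgroup.stabilizer_inf_mul_eq hle p htrans,
    Subgroup.mul_stabilizer_inf_eq hle p htrans⟩
end

section
/- Let n ≥ 4 be even, let σ = finRotate n be the n-cycle in S_n = Equiv.Perm (Fin n), let P be the stabilizer of a fixed point p ∈ Fin n, and let A_{n−1} = P ∩ A_n be the subgroup of even permutations fixing p. Then σ is an odd permutation, the set product A_{n−1}·⟨σ⟩ is not (the underlying set of) a subgroup of S_n, and consequently A_{n−1}·⟨σ⟩ ≠ ⟨σ⟩·A_{n−1}. -/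
open scoped Pointwise

/-- A power of the full cycle with a fixed point is trivial. -/
theorem finRotate_zpow_eq_one_of_apply_eq {n : ℕ} (hn : 2 ≤ n) {k : ℤ} {q : Fin n}
    (h : (finRotate n ^ k) q = q) : finRotate n ^ k = 1 := by
  have hc := isCycle_finRotate_of_le hn
  have moved (x : Fin n) : finRotate n x ≠ x := by
    rw [← Equiv.Perm.mem_support, support_finRotate_of_le hn]
    exact Finset.mem_univ x
  ext1 x
  obtain ⟨j, rfl⟩ := hc.exists_zpow_eq (moved q) (moved x)
  rw [← Equiv.Perm.mul_apply, ← zpow_add, add_comm, zpow_add, Equiv.Perm.mul_apply, h,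
    Equiv.Perm.one_apply]

/-- The exponent of a power of the full cycle with a fixed point is a multiple of `n`. -/
theorem dvd_of_finRotate_zpow_apply_eq {n : ℕ} (hn : 2 ≤ n) {k : ℤ} {q : Fin n}
    (h : (finRotate n ^ k) q = q) : (n : ℤ) ∣ k := by
  have ho : orderOf (finRotate n) = n := by
    rw [(isCycle_finRotate_of_le hn).orderOf, support_finRotate_of_le hn, Finset.card_univ,
      Fintype.card_fin]
  have := orderOf_dvd_iff_zpow_eq_one.2 (finRotate_zpow_eq_one_of_apply_eq hn h)
  rwa [ho] at this

theorem sign_finRotate_of_even {n : ℕ} (hn : n ≠ 0) (heven : Even n) :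
    Equiv.Perm.sign (finRotate n) = -1 := by
  rw [sign_finRotate]
  exact (Nat.Even.sub_odd (Nat.one_le_iff_ne_zero.2 hn) heven odd_one).neg_one_pow

/-- For even `n ≥ 4` some product `σ * a`, with `a` a 3-cycle fixing `p`, does not lie in
`A_{n-1}·⟨σ⟩`. -/
theorem exists_finRotate_mul_notMem {n : ℕ} (hn : 4 ≤ n) (heven : Even n) (p : Fin n) :
    ∃ a ∈ MulAction.stabilizer (Equiv.Perm (Fin n)) p ⊓ alternatingGroup (Fin n),
      finRotate n * a ∉
        ((MulAction.stabilizer (Equiv.Perm (Fin n)) p ⊓ alternatingGroup (Fin n) :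
          Subgroup (Equiv.Perm (Fin n))) : Set (Equiv.Perm (Fin n))) *
        (Subgroup.zpowers (finRotate n) : Set (Equiv.Perm (Fin n))) := by
  have hsign := sign_finRotate_of_even (by omega) heven
  have hne {i j : ℤ} (h0 : i < j) (h4 : j - i < 4) :
      (finRotate n ^ i) p ≠ (finRotate n ^ j) p := by
    intro h
    have hfix : (finRotate n ^ (j - i)) ((finRotate n ^ i) p) = (finRotate n ^ i) p := by
      rw [← Equiv.Perm.mul_apply, ← zpow_add, sub_add_cancel, h]
    have := Int.le_of_dvd (by omega) (dvd_of_finRotate_zpow_apply_eq (by omega) hfix)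
    omega
  have hyp := hne (i := -2) (j := 0) (by norm_num) (by norm_num)
  have hyz := hne (i := -2) (j := 1) (by norm_num) (by norm_num)
  have hxp := hne (i := -1) (j := 0) (by norm_num) (by norm_num)
  have hxz := hne (i := -1) (j := 1) (by norm_num) (by norm_num)
  have hpz := hne (i := 0) (j := 1) (by norm_num) (by norm_num)
  have hx : finRotate n ((finRotate n ^ (-1 : ℤ)) p) = p := by
    rw [zpow_neg_one, ← Equiv.Perm.mul_apply, mul_inv_cancel, Equiv.Perm.one_apply]
  have hy (k : ℤ) :
      (finRotate n ^ k) ((finRotate n ^ (-2 : ℤ)) p) = (finRotate n ^ (k - 2)) p := by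
    rw [← Equiv.Perm.mul_apply, ← zpow_add, sub_eq_add_neg]
  rw [zpow_zero, Equiv.Perm.one_apply] at hyp hxp hpz
  generalize (finRotate n ^ (-1 : ℤ)) p = x at *
  generalize (finRotate n ^ (-2 : ℤ)) p = y at *
  generalize (finRotate n ^ (1 : ℤ)) p = z at *
  have ha_sign : Equiv.Perm.sign (Equiv.swap x z * Equiv.swap y z) = 1 := by
    rw [map_mul, Equiv.Perm.sign_swap hxz, Equiv.Perm.sign_swap hyz, neg_mul_neg, one_mul]
  refine ⟨Equiv.swap x z * Equiv.swap y z, ⟨?_, Equiv.Perm.mem_alternatingGroup.2 ha_sign⟩, ?_⟩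
  · change (Equiv.swap x z * Equiv.swap y z) p = p
    rw [Equiv.Perm.mul_apply, Equiv.swap_apply_of_ne_of_ne hyp.symm hpz,
      Equiv.swap_apply_of_ne_of_ne hxp.symm hpz]
  · rintro ⟨b, ⟨hbp, hb⟩, _, ⟨k, rfl⟩, h⟩
    replace hbp : b p = p := hbp
    have hb_sign := Equiv.Perm.mem_alternatingGroup.1 hb
    have h : b * finRotate n ^ k = finRotate n * (Equiv.swap x z * Equiv.swap y z) := h
    have hky : (finRotate n ^ k) y = p := by
      apply b.injective
      rw [hbp, ← Equiv.Perm.mul_apply, h, Equiv.Perm.mul_apply, Equiv.Perm.mul_apply,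
        Equiv.swap_apply_left, Equiv.swap_apply_right, hx]
    rw [hy] at hky
    have hk : finRotate n ^ k = finRotate n ^ (2 : ℤ) := by
      rw [← sub_add_cancel k 2, zpow_add, finRotate_zpow_eq_one_of_apply_eq (by omega) hky,
        one_mul]
    have := congrArg Equiv.Perm.sign h
    rw [hk, map_mul, map_mul, map_zpow, ha_sign, hb_sign, hsign] at this
    exact absurd this (by decide)

/-- Let `n ≥ 4` be even, `σ = finRotate n` the `n`-cycle in `S_n = Equiv.Perm (Fin n)`,
`P` the stabilizer of a point `p ∈ Fin n`, and `A_{n-1} = P ∩ A_n` the even permutations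
fixing `p`.  Then `σ` is odd, the set product `A_{n-1}·⟨σ⟩` is not (the underlying set
of) a subgroup of `S_n`, and `A_{n-1}·⟨σ⟩ ≠ ⟨σ⟩·A_{n-1}`. -/
theorem alternating_nonfactorization_of_even
    (n : ℕ) (hn : 4 ≤ n) (heven : Even n) (p : Fin n) :
    Equiv.Perm.sign (finRotate n) = -1 ∧
    (¬ ∃ K : Subgroup (Equiv.Perm (Fin n)), (K : Set (Equiv.Perm (Fin n))) =
      ((MulAction.stabilizer (Equiv.Perm (Fin n)) p ⊓ alternatingGroup (Fin n) :
          Subgroup (Equiv.Perm (Fin n))) : Set (Equiv.Perm (Fin n))) *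
        (Subgroup.zpowers (finRotate n) : Set (Equiv.Perm (Fin n)))) ∧
    ((MulAction.stabilizer (Equiv.Perm (Fin n)) p ⊓ alternatingGroup (Fin n) :
        Subgroup (Equiv.Perm (Fin n))) : Set (Equiv.Perm (Fin n))) *
        (Subgroup.zpowers (finRotate n) : Set (Equiv.Perm (Fin n))) ≠
      (Subgroup.zpowers (finRotate n) : Set (Equiv.Perm (Fin n))) *
        ((MulAction.stabilizer (Equiv.Perm (Fin n)) p ⊓ alternatingGroup (Fin n) :
          Subgroup (Equiv.Perm (Fin n))) : Set (Equiv.Perm (Fin n))) := by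
  obtain ⟨a, ha, hnot⟩ := exists_finRotate_mul_notMem hn heven p
  refine ⟨sign_finRotate_of_even (by omega) heven, ?_, fun h => hnot ?_⟩
  · rintro ⟨K, hK⟩
    have hσ : finRotate n ∈ K := by
      rw [← SetLike.mem_coe, hK]
      exact ⟨1, one_mem _, _, Subgroup.mem_zpowers _, one_mul _⟩
    have haK : a ∈ K := by
      rw [← SetLike.mem_coe, hK]
      exact ⟨a, ha, 1, one_mem _, mul_one _⟩
    rw [← hK] at hnot
    exact hnot (mul_mem hσ haK)
  · rw [h]
    exact Set.mul_mem_mul (Subgroup.mem_zpowers _) ha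
end

section
/- For n ≥ 2, the stabilizer subgroup P = {π ∈ S_n : π(p) = p} of a point p ∈ Fin n is a maximal subgroup of the symmetric group S_n = Equiv.Perm (Fin n); that is, P ≠ S_n and there is no subgroup K with P ⊊ K ⊊ S_n (P is a coatom in the subgroup lattice). -/
/-- For `n ≥ 2`, the stabilizer `P = {π ∈ S_n : π p = p}` of a point `p ∈ Fin n` is a
maximal subgroup of `S_n = Equiv.Perm (Fin n)`: it is a coatom in the subgroup lattice,
i.e. `P ≠ S_n` and there is no subgroup strictly between `P` and `S_n`. -/
theorem stabilizer_isCoatom (n : ℕ) (hn : 2 ≤ n) (p : Fin n) :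
    IsCoatom (MulAction.stabilizer (Equiv.Perm (Fin n)) p) := by
  have : Nontrivial (Fin n) := Fin.nontrivial_iff_two_le.mpr hn
  exact MulAction.IsPreprimitive.isCoatom_stabilizer_of_isPreprimitive _ p
end
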